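/- For every finite connected simple port-labeled graph G with n vertices, every root vertex v_R, and every integer k with 1 ≤ k ≤ n, the total number of moves made by the k-stopped port-DFS traversal is at most 4·m', where m' is the number of edges of the induced subgraph G[V']; in particular, since m' ≤ k(k−1)/2, the k-stopped traversal makes at most 2k(k−1) moves. -/

import Mathlib

open scoped Classical

/-- Direction of a move of the port-DFS traversal. -/
inductive PDir : Type where
  | fwd : PDir
  | bwd : PDir
deriving DecidableEq

/-- Position of the port-DFS walk: before the first move (`start`, at the root),
having just arrived at `cur` via in-port `inPort` with direction `dir` (`moving`),
or halted at a vertex. -/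
inductive PPos (V : Type) : Type where
  | start : PPos V
  | moving : V → ℕ → PDir → PPos V
  | halted : V → PPos V

/-- Full state of the port-DFS traversal: position, set `S` of visited vertices,
and parent-port assignment `par`. -/
structure PState (V : Type) : Type where
  pos : PPos V
  vis : Finset V
  par : V → ℕ

/-- A finite connected simple port-labeled graph: for every vertex `u` of degree
`deg u`, the edges incident to `u` are labeled by distinct ports `0, …, deg u - 1`;
`port u v` is the port at `u` of the edge `{u, v}`. -/
structure PortedGraph (V : Type) [Fintype V] [DecidableEq V] : Type where
  G : SimpleGraph V
  conn : G.Connected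
  deg : V → ℕ
  port : V → V → ℕ
  port_lt : ∀ {u v : V}, G.Adj u v → port u v < deg u
  port_inj : ∀ {u v w : V}, G.Adj u v → G.Adj u w → port u v = port u w → v = w
  port_surj : ∀ {u : V} (p : ℕ), p < deg u → ∃ v : V, G.Adj u v ∧ port u v = p

namespace PortedGraph

variable {V : Type} [Fintype V] [DecidableEq V]

/-- The neighbor of `u` reached from `u` through port `p`. -/
noncomputable def dest (P : PortedGraph V) (u : V) (p : ℕ) : V :=
  if h : ∃ v : V, P.G.Adj u v ∧ P.port u v = p then h.choose else u

/-- One step of the port-DFS traversal from root `vR`.  A state with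
`pos = moving v q d` means the walk has just arrived at `v` via port `q` (at `v`)
with direction `d`, and `vis`/`par` are the data from before processing this
arrival; the step processes the arrival according to rules (i)–(v) and performs
the next move (or halts). -/
noncomputable def step (P : PortedGraph V) (vR : V) (s : PState V) : PState V :=
  match s.pos with
  | PPos.start =>
      if 0 < P.deg vR then
        { pos := PPos.moving (P.dest vR 0) (P.port (P.dest vR 0) vR) PDir.fwd,
          vis := s.vis, par := s.par }
      else
        { pos := PPos.halted vR, vis := s.vis, par := s.par }
  | PPos.halted v => { pos := PPos.halted v, vis := s.vis, par := s.par }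
  | PPos.moving v q PDir.fwd =>
      if v ∈ s.vis then
        -- rule (ii): leave via `q` with direction backward
        { pos := PPos.moving (P.dest v q) (P.port (P.dest v q) v) PDir.bwd,
          vis := s.vis, par := s.par }
      else
        -- rule (i): add `v` to `S`, set `par v := q`, leave via `(q+1) % deg v`
        { pos := PPos.moving (P.dest v ((q + 1) % P.deg v))
            (P.port (P.dest v ((q + 1) % P.deg v)) v)
            (if (q + 1) % P.deg v = q then PDir.bwd else PDir.fwd),
          vis := insert v s.vis, par := Function.update s.par v q }
  | PPos.moving v q PDir.bwd =>
      if v ≠ vR ∧ (q + 1) % P.deg v = s.par v then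
        -- rule (iii): leave via the parent port with direction backward
        { pos := PPos.moving (P.dest v (s.par v)) (P.port (P.dest v (s.par v)) v) PDir.bwd,
          vis := s.vis, par := s.par }
      else if v = vR ∧ (q + 1) % P.deg v = 0 then
        -- rule (iv): halt
        { pos := PPos.halted v, vis := s.vis, par := s.par }
      else
        -- rule (v): leave via `(q+1) % deg v` with direction forward
        { pos := PPos.moving (P.dest v ((q + 1) % P.deg v))
            (P.port (P.dest v ((q + 1) % P.deg v)) v) PDir.fwd,
          vis := s.vis, par := s.par }

/-- The trace of the port-DFS traversal from `vR`:  `trace P vR t` is the state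
after `t` transitions; every transition except those into/out of a halted
position is a move along an edge. -/
noncomputable def trace (P : PortedGraph V) (vR : V) : ℕ → PState V
  | 0 => { pos := PPos.start, vis := {vR}, par := fun _ => 0 }
  | t + 1 => P.step vR (P.trace vR t)

/-- The first time at which `k` distinct vertices have been visited; the
`k`-stopped traversal is the traversal halted at that moment (at which point the
walk, having made `stopTime - 1` moves, stands at the `k`-th visited vertex). -/
noncomputable def stopTime (P : PortedGraph V) (vR : V) (k : ℕ) : ℕ :=
  sInf {t : ℕ | k ≤ ((P.trace vR t).vis).card}

/-- `V'`: the set of vertices visited by the `k`-stopped traversal. -/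
noncomputable def visitedBy (P : PortedGraph V) (vR : V) (k : ℕ) : Finset V :=
  (P.trace vR (P.stopTime vR k)).vis

/-- `V'` as a set. -/
noncomputable def Vset (P : PortedGraph V) (vR : V) (k : ℕ) : Set V :=
  ↑(P.visitedBy vR k)

/-- The parent-port assignment at the end of the `k`-stopped traversal. -/
noncomputable def parFinal (P : PortedGraph V) (vR : V) (k : ℕ) : V → ℕ :=
  (P.trace vR (P.stopTime vR k)).par

/-- `u(v)`: the neighbor of `v` reached from `v` through its parent port. -/
noncomputable def parentVert (P : PortedGraph V) (vR : V) (k : ℕ) (v : V) : V :=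
  P.dest v (P.parFinal vR k v)

/-- `v_L`: the `k`-th (last) vertex added to `S` by the `k`-stopped traversal. -/
noncomputable def lastVert (P : PortedGraph V) (vR : V) (k : ℕ) : V :=
  if h : ∃ v : V, v ∈ P.visitedBy vR k ∧ v ∉ (P.trace vR (P.stopTime vR k - 1)).vis
  then h.choose else vR

/-- The tree `T` of parent edges `{v, u(v)}`, `v ∈ V' \ {v_R}`, as a graph on `V`
(vertices outside `V'` are isolated). -/
noncomputable def treeRel (P : PortedGraph V) (vR : V) (k : ℕ) : SimpleGraph V :=
  SimpleGraph.fromRel (fun a b =>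
    a ∈ P.visitedBy vR k ∧ a ≠ vR ∧ b = P.parentVert vR k a)

/-- The tree `T` of parent edges as a graph on the vertex set `V'`. -/
noncomputable def treeSub (P : PortedGraph V) (vR : V) (k : ℕ) :
    SimpleGraph (P.Vset vR k) :=
  SimpleGraph.fromRel (fun a b => (a : V) ≠ vR ∧ (b : V) = P.parentVert vR k (a : V))

/-- `v` lies on the rootpath: the unique path in `T` from `v_R` to `v_L`. -/
def onRootpath (P : PortedGraph V) (vR : V) (k : ℕ) (v : V) : Prop :=
  ∃ p : (P.treeRel vR k).Walk vR (P.lastVert vR k), p.IsPath ∧ v ∈ p.support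

/-- The move made out of state `s`:  `some (v, p, d)` if the walk leaves vertex
`v` via port `p` with direction `d`, and `none` if it halts (or already halted). -/
noncomputable def exitEvent (P : PortedGraph V) (vR : V) (s : PState V) :
    Option (V × ℕ × PDir) :=
  match s.pos with
  | PPos.start => if 0 < P.deg vR then some (vR, 0, PDir.fwd) else none
  | PPos.halted _ => none
  | PPos.moving v q PDir.fwd =>
      if v ∈ s.vis then some (v, q, PDir.bwd)
      else some (v, (q + 1) % P.deg v,
        if (q + 1) % P.deg v = q then PDir.bwd else PDir.fwd)
  | PPos.moving v q PDir.bwd =>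
      if v ≠ vR ∧ (q + 1) % P.deg v = s.par v then some (v, s.par v, PDir.bwd)
      else if v = vR ∧ (q + 1) % P.deg v = 0 then none
      else some (v, (q + 1) % P.deg v, PDir.fwd)

end PortedGraph

namespace PortedGraph

section Traversal

variable {V : Type} [Fintype V] [DecidableEq V] (P : PortedGraph V)

lemma dest_spec {u : V} {p : ℕ} (h : p < P.deg u) :
    P.G.Adj u (P.dest u p) ∧ P.port u (P.dest u p) = p := by
  have h' := P.port_surj p h
  rw [dest, dif_pos h']
  exact h'.choose_spec

lemma dest_port {u v : V} (h : P.G.Adj u v) : P.dest u (P.port u v) = v := by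
  obtain ⟨h₁, h₂⟩ := P.dest_spec (P.port_lt h)
  exact P.port_inj h₁ h h₂

lemma next_port_lt {v : V} {q : ℕ} (h : q < P.deg v) : (q + 1) % P.deg v < P.deg v :=
  Nat.mod_lt _ (by omega)

lemma next_port_inj {d q r : ℕ} (hq : q < d) (hr : r < d) (h : (q + 1) % d = (r + 1) % d) :
    q = r := by
  have hmod : q ≡ r [MOD d] := Nat.ModEq.add_right_cancel' 1 h
  rwa [Nat.ModEq, Nat.mod_eq_of_lt hq, Nat.mod_eq_of_lt hr] at hmod

/-- The invariant of the port-DFS traversal: parents are visited before their children, and the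
walk never leaves a vertex forward, nor enters it backward, through its parent port. -/
structure Inv (vR : V) (s : PState V) : Prop where
  root_mem : vR ∈ s.vis
  par_lt : ∀ v ∈ s.vis, v ≠ vR → s.par v < P.deg v
  parent_mem : ∀ v ∈ s.vis, v ≠ vR → P.dest v (s.par v) ∈ s.vis
  no_two_cycle : ∀ u ∈ s.vis, ∀ v ∈ s.vis, u ≠ vR → v ≠ vR →
    P.dest u (s.par u) = v → P.dest v (s.par v) ≠ u
  port_lt_deg : ∀ v q d, s.pos = PPos.moving v q d → q < P.deg v
  source_mem : ∀ v q d, s.pos = PPos.moving v q d → P.dest v q ∈ s.vis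
  bwd_mem : ∀ v q, s.pos = PPos.moving v q PDir.bwd → v ∈ s.vis
  bwd_ne_par : ∀ v q, s.pos = PPos.moving v q PDir.bwd → v ≠ vR → q ≠ s.par v
  fwd_ne_par : ∀ v q, s.pos = PPos.moving v q PDir.fwd → P.dest v q ≠ vR →
    P.port (P.dest v q) v ≠ s.par (P.dest v q)

variable {P} {vR : V}

lemma Inv.of_move {s : PState V} (h : P.Inv vR s) {v : V} {p : ℕ} {d : PDir}
    (hv : v ∈ s.vis) (hp : p < P.deg v)
    (hb : d = PDir.bwd → P.dest v p ∈ s.vis ∧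
      (P.dest v p ≠ vR → P.port (P.dest v p) v ≠ s.par (P.dest v p)))
    (hf : d = PDir.fwd → v ≠ vR → p ≠ s.par v) :
    P.Inv vR { pos := PPos.moving (P.dest v p) (P.port (P.dest v p) v) d,
               vis := s.vis, par := s.par } := by
  obtain ⟨hadj, hport⟩ := P.dest_spec hp
  have hback := P.dest_port hadj.symm
  refine ⟨h.root_mem, h.par_lt, h.parent_mem, h.no_two_cycle, ?_, ?_, ?_, ?_, ?_⟩
  · intro w r e he
    cases he
    exact P.port_lt hadj.symm
  · intro w r e he
    cases he
    rwa [hback]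
  · intro w r he
    cases he
    exact (hb rfl).1
  · intro w r he
    cases he
    exact (hb rfl).2
  · intro w r he
    cases he
    rw [hback, hport]
    exact hf rfl

lemma Inv.visit {s : PState V} (h : P.Inv vR s) {v : V} {q : ℕ}
    (hpos : s.pos = PPos.moving v q PDir.fwd) (hv : v ∉ s.vis) :
    P.Inv vR { pos := PPos.start, vis := insert v s.vis, par := Function.update s.par v q } := by
  have hq := h.port_lt_deg v q _ hpos
  have hsrc := h.source_mem v q _ hpos
  have hne : ∀ u ∈ s.vis, u ≠ v := fun u hu e => hv (e ▸ hu)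
  refine ⟨Finset.mem_insert_of_mem h.root_mem, ?_, ?_, ?_, by simp, by simp, by simp, by simp,
    by simp⟩
  · intro u hu hur
    rcases Finset.mem_insert.1 hu with rfl | hu
    · simpa using hq
    · simpa [hne u hu] using h.par_lt u hu hur
  · intro u hu hur
    rcases Finset.mem_insert.1 hu with rfl | hu
    · simpa using Or.inr hsrc
    · simpa [hne u hu] using Or.inr (h.parent_mem u hu hur)
  · intro u hu w hw hur hwr huw hwu
    rcases Finset.mem_insert.1 hu with rfl | hu'
    · rcases Finset.mem_insert.1 hw with rfl | hw'
      · simp only [Function.update_self] at huw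
        exact hv (huw ▸ hsrc)
      · simp only [ne_eq, hne w hw', not_false_eq_true, Function.update_of_ne] at hwu
        exact hv (hwu ▸ h.parent_mem w hw' hwr)
    · simp only [ne_eq, hne u hu', not_false_eq_true, Function.update_of_ne] at huw
      rcases Finset.mem_insert.1 hw with rfl | hw'
      · exact hv (huw ▸ h.parent_mem u hu' hur)
      · simp only [ne_eq, hne w hw', not_false_eq_true, Function.update_of_ne] at hwu
        exact h.no_two_cycle u hu' w hw' hur hwr huw hwu

lemma Inv.halt {s : PState V} (h : P.Inv vR s) (v : V) :
    P.Inv vR { pos := PPos.halted v, vis := s.vis, par := s.par } :=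
  ⟨h.root_mem, h.par_lt, h.parent_mem, h.no_two_cycle, by simp, by simp, by simp, by simp,
    by simp⟩

lemma Inv.step {s : PState V} (h : P.Inv vR s) : P.Inv vR (P.step vR s) := by
  unfold PortedGraph.step
  split
  · split_ifs with h0
    · exact h.of_move h.root_mem h0 (by simp) (by simp)
    · exact h.halt _
  · exact h.halt _
  · rename_i v q hpos
    have hq := h.port_lt_deg v q _ hpos
    have hsrc := h.source_mem v q _ hpos
    split_ifs with hv hm
    · exact h.of_move hv hq (fun _ => ⟨hsrc, h.fwd_ne_par v q hpos⟩) (by simp)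
    · rw [hm]
      have hne : P.dest v q ≠ v := fun e => hv (e ▸ hsrc)
      refine (h.visit hpos hv).of_move (Finset.mem_insert_self _ _) hq
        (fun _ => ⟨Finset.mem_insert_of_mem hsrc, ?_⟩) (by simp)
      simpa [hne] using h.fwd_ne_par v q hpos
    · exact (h.visit hpos hv).of_move (Finset.mem_insert_self _ _) (P.next_port_lt hq)
        (by simp) (by simpa using fun _ => hm)
  · rename_i v q hpos
    have hq := h.port_lt_deg v q _ hpos
    have hv := h.bwd_mem v q hpos
    split_ifs with h3 h4
    · refine h.of_move hv (h.par_lt v hv h3.1)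
        (fun _ => ⟨h.parent_mem v hv h3.1, fun hr he => ?_⟩) (by simp)
      have hadj := (P.dest_spec (h.par_lt v hv h3.1)).1
      refine h.no_two_cycle v hv _ (h.parent_mem v hv h3.1) h3.1 hr rfl ?_
      rw [← he, P.dest_port hadj.symm]
    · exact h.halt _
    · exact h.of_move hv (P.next_port_lt hq) (by simp) (fun _ hr he => h3 ⟨hr, he⟩)

variable (P vR)

lemma inv_trace (t : ℕ) : P.Inv vR (P.trace vR t) := by
  induction t with
  | zero => constructor <;> simp [trace]
  | succ t ih => exact ih.step

lemma step_vis (s : PState V) : (P.step vR s).vis = s.vis ∨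
    ∃ v, (P.step vR s).vis = insert v s.vis := by
  unfold step
  split <;> (try split_ifs) <;> first | exact Or.inl rfl | exact Or.inr ⟨_, rfl⟩

lemma vis_mono : Monotone fun t => (P.trace vR t).vis := by
  refine monotone_nat_of_le_succ fun t => ?_
  rcases P.step_vis vR (P.trace vR t) with h | ⟨v, h⟩ <;> simp [trace, h]

lemma step_par (s : PState V) {v : V} (hv : v ∈ s.vis) : (P.step vR s).par v = s.par v := by
  unfold step
  split <;> (try split_ifs) <;> try rfl
  all_goals exact Function.update_of_ne (by rintro rfl; contradiction) _ _

lemma par_eq {i j : ℕ} (hij : i ≤ j) {v : V} (hv : v ∈ (P.trace vR i).vis) :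
    (P.trace vR j).par v = (P.trace vR i).par v := by
  induction j, hij using Nat.le_induction with
  | base => rfl
  | succ j hj ih => exact (P.step_par vR _ (P.vis_mono vR hj hv)).trans ih

lemma mem_vis_succ {t : ℕ} {v : V} {q : ℕ} {d : PDir}
    (h : (P.trace vR t).pos = PPos.moving v q d) : v ∈ (P.trace vR (t + 1)).vis := by
  cases d with
  | bwd => exact P.vis_mono vR t.le_succ ((P.inv_trace vR t).bwd_mem v q h)
  | fwd =>
    by_cases hv : v ∈ (P.trace vR t).vis
    · exact P.vis_mono vR t.le_succ hv
    · simp [trace, step, h, hv]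

lemma par_visit {i j : ℕ} (hij : i < j) {v : V} {q : ℕ}
    (h : (P.trace vR i).pos = PPos.moving v q PDir.fwd) (hv : v ∉ (P.trace vR i).vis) :
    (P.trace vR j).par v = q := by
  rw [P.par_eq vR hij (P.mem_vis_succ vR h)]
  simp [trace, step, h, hv]

/-- Every visited non-root vertex was entered forward through its parent port. -/
lemma exists_visit (t : ℕ) : ∀ v ∈ (P.trace vR t).vis, v ≠ vR →
    ∃ i < t, (P.trace vR i).pos = PPos.moving v ((P.trace vR t).par v) PDir.fwd := by
  induction t with
  | zero => intro v hv hr; simp [trace] at hv; contradiction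
  | succ t ih =>
    intro v hv hr
    by_cases hv' : v ∈ (P.trace vR t).vis
    · obtain ⟨i, hi, h⟩ := ih v hv' hr
      exact ⟨i, by omega, by rw [h, P.par_eq vR t.le_succ hv']⟩
    · cases hp : (P.trace vR t).pos with
      | start => simp [trace, step, hp] at hv; split_ifs at hv <;> contradiction
      | halted w => simp [trace, step, hp] at hv; contradiction
      | moving w q d =>
        have hwv : v = w := by
          cases d <;> simp only [trace, step, hp] at hv <;> split_ifs at hv <;>
            simp_all
        subst hwv
        cases d with
        | bwd => exact absurd ((P.inv_trace vR t).bwd_mem v q hp) hv'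
        | fwd => exact ⟨t, t.lt_succ_self, by rw [hp, P.par_visit vR t.lt_succ_self hp hv']⟩

lemma exitEvent_of_step {s : PState V} {w : V} {r : ℕ} {d : PDir}
    (h : (P.step vR s).pos = PPos.moving w r d) :
    ∃ v p, P.exitEvent vR s = some (v, p, d) ∧ w = P.dest v p ∧ r = P.port w v := by
  obtain ⟨pos, vis, par⟩ := s
  rcases pos with _ | ⟨v, q, _ | _⟩ | v <;> simp only [step, exitEvent] at h ⊢ <;>
    (try split_ifs at h ⊢) <;> cases h <;> exact ⟨_, _, rfl, rfl, rfl⟩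

variable {P vR} in
lemma Inv.exit_port_lt {s : PState V} (h : P.Inv vR s) {v : V} {p : ℕ} {d : PDir}
    (he : P.exitEvent vR s = some (v, p, d)) : p < P.deg v := by
  unfold exitEvent at he
  split at he
  · split_ifs at he with h0
    cases he
    exact h0
  · cases he
  · rename_i w q hpos
    have hq := h.port_lt_deg w q _ hpos
    split_ifs at he <;> cases he
    exacts [hq, P.next_port_lt hq, P.next_port_lt hq]
  · rename_i w q hpos
    have hq := h.port_lt_deg w q _ hpos
    split_ifs at he with h3 <;> cases he
    exacts [h.par_lt _ (h.bwd_mem _ q hpos) h3.1, P.next_port_lt hq]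

lemma exitEvent_of_pos_succ {t : ℕ} {w : V} {r : ℕ} {d : PDir}
    (h : (P.trace vR (t + 1)).pos = PPos.moving w r d) :
    P.exitEvent vR (P.trace vR t) = some (P.dest w r, P.port (P.dest w r) w, d) := by
  obtain ⟨v, p, he, rfl, rfl⟩ := P.exitEvent_of_step vR h
  obtain ⟨hadj, hport⟩ := P.dest_spec ((P.inv_trace vR t).exit_port_lt he)
  rw [P.dest_port hadj.symm, hport, he]

lemma pos_succ_ne_start (t : ℕ) : (P.trace vR (t + 1)).pos ≠ PPos.start := by
  simp only [trace, step]
  split <;> (try split_ifs) <;> simp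

lemma exists_eq_pos_of_exitEvent_eq {i j : ℕ} (hij : i < j) {v : V} {p : ℕ} {d : PDir}
    (hi : P.exitEvent vR (P.trace vR i) = some (v, p, d))
    (hj : P.exitEvent vR (P.trace vR j) = some (v, p, d)) :
    ∃ a b w r e, a < b ∧ b ≤ j ∧ (P.trace vR a).pos = PPos.moving w r e ∧
      (P.trace vR b).pos = PPos.moving w r e := by
  have Ii := P.inv_trace vR i
  have Ij := P.inv_trace vR j
  have hmono : (P.trace vR i).vis ⊆ (P.trace vR j).vis := P.vis_mono vR hij.le
  cases hpj : (P.trace vR j).pos with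
  | start =>
    obtain ⟨j, rfl⟩ : ∃ m, j = m + 1 := ⟨j - 1, by omega⟩
    exact absurd hpj (P.pos_succ_ne_start vR j)
  | halted x => simp [exitEvent, hpj] at hj
  | moving x q' d' =>
  have hq' := Ij.port_lt_deg _ _ _ hpj
  cases hpi : (P.trace vR i).pos with
  | halted x => simp [exitEvent, hpi] at hi
  | start =>
    simp only [exitEvent, hpi] at hi
    split_ifs at hi
    cases hi
    cases d' <;> simp only [exitEvent, hpj] at hj <;> split_ifs at hj <;> grind [Inv]
  | moving y q e =>
  have hq := Ii.port_lt_deg _ _ _ hpi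
  have hy : y ∈ (P.trace vR j).vis := P.vis_mono vR hij (P.mem_vis_succ vR hpi)
  cases e with
  | fwd =>
    have hroot : y ∉ (P.trace vR i).vis → y ≠ vR := fun h e => h (e ▸ Ii.root_mem)
    have hpar := fun h => P.par_visit vR hij hpi h
    have hold : y ∈ (P.trace vR i).vis → y ≠ vR → (P.trace vR j).par y = q →
        ∃ a b w r e, a < b ∧ b ≤ j ∧ (P.trace vR a).pos = PPos.moving w r e ∧
          (P.trace vR b).pos = PPos.moving w r e := by
      intro h hr he
      obtain ⟨a, ha, hpa⟩ := P.exists_visit vR i y h hr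
      rw [← P.par_eq vR hij.le h, he] at hpa
      exact ⟨a, i, _, _, _, ha, hij.le, hpa, hpi⟩
    cases d' with
    | fwd =>
      refine ⟨i, j, y, q, _, hij, le_rfl, hpi, ?_⟩
      simp only [exitEvent, hpi, hpj] at hi hj ⊢
      split_ifs at hi hj <;> grind
    | bwd =>
      have hne := Ij.bwd_ne_par _ _ hpj
      have hinj := fun h => next_port_inj (d := P.deg y) (q := q) (r := q') hq h
      simp only [exitEvent, hpi, hpj] at hi hj
      split_ifs at hi hj <;> grind
  | bwd =>
    have hvis := Ii.bwd_mem _ _ hpi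
    have hpar := P.par_eq vR hij.le hvis
    cases d' with
    | fwd =>
      have hold : y ≠ vR → (P.trace vR j).par y = q' → x = y →
          ∃ a b w r e, a < b ∧ b ≤ j ∧ (P.trace vR a).pos = PPos.moving w r e ∧
            (P.trace vR b).pos = PPos.moving w r e := by
        rintro hr he rfl
        obtain ⟨a, ha, hpa⟩ := P.exists_visit vR j x hy hr
        rw [he] at hpa
        exact ⟨a, j, _, _, _, ha, le_rfl, hpa, hpj⟩
      simp only [exitEvent, hpi, hpj] at hi hj
      split_ifs at hi hj <;> grind
    | bwd =>
      refine ⟨i, j, y, q, _, hij, le_rfl, hpi, ?_⟩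
      have hinj := fun h => next_port_inj (d := P.deg y) (q := q) (r := q') hq h
      simp only [exitEvent, hpi, hpj] at hi hj ⊢
      split_ifs at hi hj <;> grind

/-- The walk never enters the same vertex through the same port in the same direction twice. -/
lemma pos_ne_of_lt (j : ℕ) : ∀ i < j, ∀ v q d,
    (P.trace vR i).pos = PPos.moving v q d → (P.trace vR j).pos ≠ PPos.moving v q d := by
  induction j using Nat.strong_induction_on with
  | _ j ih =>
    intro i hij v q d hi hj
    cases i with
    | zero => simp [trace] at hi
    | succ i =>
      obtain ⟨j, rfl⟩ : ∃ m, j = m + 1 := ⟨j - 1, by omega⟩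
      obtain ⟨a, b, w, r, e, hab, hbj, ha, hb⟩ := P.exists_eq_pos_of_exitEvent_eq vR
        (by omega : i < j) (P.exitEvent_of_pos_succ vR hi) (P.exitEvent_of_pos_succ vR hj)
      exact ih b (by omega) a hab w r e ha hb

lemma vis_eq_of_halted {i : ℕ} {v : V} (h : (P.trace vR i).pos = PPos.halted v) {j : ℕ}
    (hij : i ≤ j) : (P.trace vR j).vis = (P.trace vR i).vis := by
  suffices (P.trace vR j).pos = PPos.halted v ∧ (P.trace vR j).vis = (P.trace vR i).vis from this.2
  induction j, hij using Nat.le_induction with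
  | base => exact ⟨h, rfl⟩
  | succ j hj ih =>
    simp only [trace, step, ih.1]
    exact ⟨trivial, ih.2⟩

/-- If the visited set is enlarged at time `T`, the moves made before that time inject into the
pairs of a dart of the visited subgraph and a direction. -/
lemma moves_le {T : ℕ} (hT : ∀ t < T, (P.trace vR t).vis.card < (P.trace vR T).vis.card) :
    T - 1 ≤ 4 * (P.G.induce ((P.trace vR T).vis : Set V)).edgeSet.ncard := by
  set H := P.G.induce ((P.trace vR T).vis : Set V)
  have key : ∀ t : Fin (T - 1), ∃ x : H.Dart × Bool, (P.trace vR (t + 1)).pos =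
      PPos.moving (x.1.fst : V) (P.port x.1.fst x.1.snd) (if x.2 then PDir.fwd else PDir.bwd) := by
    intro t
    have ht : (t : ℕ) + 1 < T := by omega
    cases hp : (P.trace vR (t + 1)).pos with
    | start => exact absurd hp (P.pos_succ_ne_start vR t)
    | halted v =>
      have := hT _ ht
      rw [P.vis_eq_of_halted vR hp ht.le] at this
      exact absurd this (lt_irrefl _)
    | moving v q d =>
      have I := P.inv_trace vR (t + 1)
      obtain ⟨hadj, hport⟩ := P.dest_spec (I.port_lt_deg v q d hp)
      have hv := P.vis_mono vR ht (P.mem_vis_succ vR hp)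
      have hw := P.vis_mono vR ht.le (I.source_mem v q d hp)
      refine ⟨(⟨(⟨v, hv⟩, ⟨P.dest v q, hw⟩), hadj⟩, decide (d = PDir.fwd)), ?_⟩
      cases d <;> simp [hport]
  choose f hf using key
  have hinj : Function.Injective f := by
    intro s t hst
    have hs := hf s
    have ht := hf t
    rw [← hst] at ht
    rcases lt_trichotomy s t with h | h | h
    · exact absurd ht (P.pos_ne_of_lt vR _ _ (by simpa using h) _ _ _ hs)
    · exact h
    · exact absurd hs (P.pos_ne_of_lt vR _ _ (by simpa using h) _ _ _ ht)
  have hcard := Fintype.card_le_of_injective f hinj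
  rw [Fintype.card_fin, Fintype.card_prod, Fintype.card_bool, H.dart_card_eq_twice_card_edges,
    ← Set.ncard_coe_finset, SimpleGraph.coe_edgeFinset] at hcard
  omega

lemma card_step_vis_le (s : PState V) : (P.step vR s).vis.card ≤ s.vis.card + 1 := by
  rcases P.step_vis vR s with h | ⟨v, h⟩ <;> rw [h]
  · omega
  · exact Finset.card_insert_le _ _

lemma card_lt_of_lt_stopTime {k t : ℕ} (h : t < P.stopTime vR k) :
    (P.trace vR t).vis.card < k :=
  not_le.1 (Nat.notMem_of_lt_sInf (s := {t | k ≤ (P.trace vR t).vis.card}) h)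

lemma card_visitedBy {k : ℕ} (h : 0 < P.stopTime vR k) : (P.visitedBy vR k).card = k := by
  refine le_antisymm ?_ (Nat.sInf_mem (Nat.nonempty_of_pos_sInf h))
  have hlt := P.card_lt_of_lt_stopTime vR (Nat.sub_lt h one_pos)
  have hle := P.card_step_vis_le vR (P.trace vR (P.stopTime vR k - 1))
  obtain ⟨m, hm⟩ : ∃ m, P.stopTime vR k = m + 1 := ⟨P.stopTime vR k - 1, by omega⟩
  rw [visitedBy]
  rw [hm] at hlt hle ⊢
  exact hle.trans hlt

end Traversal

end PortedGraph

/-- for every `1 ≤ k ≤ n`, the total number of moves made by the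
`k`-stopped port-DFS traversal (namely `stopTime - 1`) is at most `4·m'`, where
`m'` is the number of edges of the induced subgraph `G[V']`; in particular it is
at most `2·k·(k-1)`. -/
theorem statement9 {V : Type} [Fintype V] [DecidableEq V]
    (P : PortedGraph V) (vR : V) (k : ℕ)
    (hk1 : 1 ≤ k) (hk2 : k ≤ Fintype.card V) :
    P.stopTime vR k - 1 ≤ 4 * (P.G.induce (P.Vset vR k)).edgeSet.ncard ∧
    P.stopTime vR k - 1 ≤ 2 * k * (k - 1) := by
  rcases Nat.eq_zero_or_pos (P.stopTime vR k) with h0 | h0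
  · simp [h0]
  have hcard := P.card_visitedBy vR h0
  have hmoves : P.stopTime vR k - 1 ≤ 4 * (P.G.induce (P.Vset vR k)).edgeSet.ncard :=
    P.moves_le vR fun t ht => (P.card_lt_of_lt_stopTime vR ht).trans_eq hcard.symm
  refine ⟨hmoves, hmoves.trans ?_⟩
  have hedges := (P.G.induce (P.Vset vR k)).card_edgeFinset_le_card_choose_two
  have hV : Fintype.card (P.Vset vR k) = k := by
    rw [← Nat.card_eq_fintype_card, Nat.card_coe_set_eq, PortedGraph.Vset, Set.ncard_coe_finset, hcard]
  rw [← Set.ncard_coe_finset, SimpleGraph.coe_edgeFinset, hV, Nat.choose_two_right] at hedges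
  have hdiv := Nat.div_mul_le_self (k * (k - 1)) 2
  rw [mul_assoc]
  omega
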